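/- Let X be a pointed metric space with base point 0, let 2 ≤ p < ∞, and let Y be a real Banach space that is an L_p-space. If T : X → Y is a Lipschitz map with T(0) = 0 such that the restriction of its Lipschitz adjoint to Y*, namely the linear map Y* → X^# sending y* to y* ∘ T, is almost p-summing, then T is Lipschitz 1-summing. -/

import Mathlib

open scoped BigOperators NNReal

/-- The weak `ℓ_p` norm of a finite family in a normed space. -/
noncomputable def weakNorm (p : ℝ) {E : Type*} [NormedAddCommGroup E] [NormedSpace ℝ E]
    {n : ℕ} (x : Fin n → E) : ℝ :=
  ⨆ φ : {φ : E →L[ℝ] ℝ // ‖φ‖ ≤ 1}, (∑ i, |φ.1 (x i)| ^ p) ^ (1 / p)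

/-- The Lipschitz norm of `g : X → ℝ`, i.e. the norm in `X^#`. -/
noncomputable def lipNorm {X : Type*} [MetricSpace X] (g : X → ℝ) : ℝ :=
  sInf {K : ℝ | 0 ≤ K ∧ ∀ x y : X, |g x - g y| ≤ K * dist x y}

/-- A map `u : E → X^#` (into functions `X → ℝ` measured with the Lipschitz norm) is almost
`p`-summing. -/
def AlmostSummingIntoLip (p : ℝ) {E X : Type*} [NormedAddCommGroup E] [NormedSpace ℝ E]
    [MetricSpace X] (u : E → X → ℝ) : Prop :=
  ∃ C : ℝ, 0 ≤ C ∧ ∀ (n : ℕ) (h : Fin n → E),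
    Real.sqrt ((2 ^ n : ℝ)⁻¹ * ∑ ε : Fin n → Bool,
        lipNorm (fun x : X => ∑ i, (if ε i then (1 : ℝ) else -1) * u (h i) x) ^ 2) ≤
      C * weakNorm p h

/-- `T : X → Y` is Lipschitz `1`-summing (base point `base`): there is `C ≥ 0` with
`∑ ‖T(xᵢ) − T(qᵢ)‖ ≤ C ⬝ sup_{φ ∈ B_{X^#}} ∑ |φ(xᵢ) − φ(qᵢ)|`. -/
def LipschitzOneSumming {X Y : Type*} [MetricSpace X] [NormedAddCommGroup Y]
    (base : X) (T : X → Y) : Prop :=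
  ∃ C : ℝ, 0 ≤ C ∧ ∀ (n : ℕ) (x q : Fin n → X),
    ∑ i, ‖T (x i) - T (q i)‖ ≤
      C * ⨆ φ : {φ : X → ℝ // LipschitzWith 1 φ ∧ φ base = 0},
        ∑ i, |φ.1 (x i) - φ.1 (q i)|

/-- The `ℓ_p` norm on `ℝ^m`. -/
noncomputable def lpNorm (p : ℝ) {m : ℕ} (y : Fin m → ℝ) : ℝ :=
  (∑ k, |y k| ^ p) ^ (1 / p)

/-- `Y` is an `L_{p,λ}`-space. -/
def IsLpSpaceWith (p lam : ℝ) (Y : Type*) [NormedAddCommGroup Y] [NormedSpace ℝ Y] : Prop :=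
  ∀ E : Submodule ℝ Y, FiniteDimensional ℝ E →
    ∃ Y₀ : Submodule ℝ Y, E ≤ Y₀ ∧ FiniteDimensional ℝ Y₀ ∧
      ∃ v : Y₀ ≃ₗ[ℝ] (Fin (Module.finrank ℝ Y₀) → ℝ), ∃ a b : ℝ,
        (∀ y : Y₀, lpNorm p (v y) ≤ a * ‖y‖) ∧
        (∀ z : Fin (Module.finrank ℝ Y₀) → ℝ, ‖v.symm z‖ ≤ b * lpNorm p z) ∧
        a * b ≤ lam

/-! ### Khintchine's inequality in `L¹` -/

/-- The Rademacher sum `∑ εᵢ aᵢ`. -/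
def signSum {n : ℕ} (a : Fin n → ℝ) (ε : Fin n → Bool) : ℝ :=
  ∑ i, (if ε i then (1 : ℝ) else -1) * a i

theorem sum_bool_fun_succ {n : ℕ} (F : (Fin (n + 1) → Bool) → ℝ) :
    ∑ ε, F ε = ∑ ε : Fin n → Bool, (F (Fin.cons true ε) + F (Fin.cons false ε)) := by
  rw [← (Fin.consEquiv fun _ => Bool).sum_comp, Fintype.sum_prod_type, Fintype.sum_bool,
    ← Finset.sum_add_distrib]
  rfl

theorem signSum_cons {n : ℕ} (a : Fin (n + 1) → ℝ) (b : Bool) (ε : Fin n → Bool) :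
    signSum a (Fin.cons b ε) =
      (if b then (1 : ℝ) else -1) * a 0 + signSum (fun i => a i.succ) ε := by
  simp [signSum, Fin.sum_univ_succ]

theorem sum_signSum_sq {n : ℕ} (a : Fin n → ℝ) :
    ∑ ε, signSum a ε ^ 2 = 2 ^ n * ∑ i, a i ^ 2 := by
  induction n with
  | zero => simp [signSum]
  | succ n ih =>
    have h : ∀ ε : Fin n → Bool,
        signSum a (Fin.cons true ε) ^ 2 + signSum a (Fin.cons false ε) ^ 2 =
          2 * (a 0 ^ 2 + signSum (fun i => a i.succ) ε ^ 2) := by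
      intro ε
      rw [signSum_cons, signSum_cons]
      simp only [if_true, Bool.false_eq_true, if_false]
      ring
    rw [sum_bool_fun_succ, Finset.sum_congr rfl fun ε _ => h ε, ← Finset.mul_sum,
      Finset.sum_add_distrib, ih, Fin.sum_univ_succ]
    simp only [Finset.sum_const, Finset.card_univ, Fintype.card_pi, Fintype.card_bool,
      Finset.prod_const, Fintype.card_fin, nsmul_eq_mul, Nat.cast_pow, Nat.cast_ofNat]
    ring

theorem sum_signSum_pow_four_le {n : ℕ} (a : Fin n → ℝ) :
    ∑ ε, signSum a ε ^ 4 ≤ 3 * 2 ^ n * (∑ i, a i ^ 2) ^ 2 := by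
  induction n with
  | zero => simp [signSum]
  | succ n ih =>
    have h : ∀ ε : Fin n → Bool,
        signSum a (Fin.cons true ε) ^ 4 + signSum a (Fin.cons false ε) ^ 4 =
          2 * a 0 ^ 4 + (12 * a 0 ^ 2 * signSum (fun i => a i.succ) ε ^ 2 +
            2 * signSum (fun i => a i.succ) ε ^ 4) := by
      intro ε
      rw [signSum_cons, signSum_cons]
      simp only [if_true, Bool.false_eq_true, if_false]
      ring
    rw [sum_bool_fun_succ, Finset.sum_congr rfl fun ε _ => h ε, Finset.sum_add_distrib,
      Finset.sum_add_distrib, ← Finset.mul_sum, ← Finset.mul_sum, ← Finset.mul_sum,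
      sum_signSum_sq, Fin.sum_univ_succ, pow_succ (2 : ℝ) n]
    have h4 := ih fun i => a i.succ
    have h2 : (0 : ℝ) ≤ 2 ^ n * (a 0 ^ 2) ^ 2 := by positivity
    simp only [Finset.sum_const, Finset.card_univ, Fintype.card_pi, Fintype.card_bool,
      Finset.prod_const, Fintype.card_fin, nsmul_eq_mul, Nat.cast_pow, Nat.cast_ofNat]
    nlinarith

/-- Khintchine's inequality in `L¹`. -/
theorem sqrt_sum_sq_le_average_abs_signSum {n : ℕ} (a : Fin n → ℝ) :
    √(∑ i, a i ^ 2) ≤ 2 * ((2 ^ n : ℝ)⁻¹ * ∑ ε, |signSum a ε|) := by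
  set σ := √(∑ i, a i ^ 2) with hσ
  have hσ2 : ∑ i, a i ^ 2 = σ ^ 2 := (Real.sq_sqrt (by positivity)).symm
  rcases (Real.sqrt_nonneg (∑ i, a i ^ 2)).eq_or_lt with h0 | hpos
  · rw [hσ, ← h0]
    positivity
  rw [← hσ] at hpos
  have key : ∀ t : ℝ, 12 * σ ^ 2 * t ^ 2 - t ^ 4 ≤ 16 * σ ^ 3 * |t| := by
    intro t
    rw [← sq_abs t, show t ^ 4 = |t| ^ 4 by rw [Even.pow_abs (by decide)]]
    have ht := abs_nonneg t
    have : 0 ≤ |t| * ((|t| - 2 * σ) ^ 2 * (|t| + 4 * σ)) := by positivity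
    nlinarith
  have hsum := Finset.sum_le_sum fun ε (_ : ε ∈ Finset.univ) => key (signSum a ε)
  rw [Finset.sum_sub_distrib, ← Finset.mul_sum, ← Finset.mul_sum, sum_signSum_sq, hσ2] at hsum
  have h4 := sum_signSum_pow_four_le a
  rw [hσ2] at h4
  have h9 : σ ^ 3 * (9 * 2 ^ n * σ) ≤ σ ^ 3 * (16 * ∑ ε, |signSum a ε|) := by nlinarith
  have h9' := le_of_mul_le_mul_left h9 (by positivity)
  have hn : (0 : ℝ) < 2 ^ n := by positivity
  rw [← mul_assoc, mul_comm 2, mul_assoc, ← div_eq_inv_mul, le_div_iff₀ hn]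
  have : 0 ≤ σ * 2 ^ n := by positivity
  linarith

/-! ### The `ℓ_p` norm over a finite index type -/

/-- The `ℓ_p` norm on `ℝ^κ` for a finite type `κ`. -/
noncomputable def finLpNorm (p : ℝ) {κ : Type*} [Fintype κ] (f : κ → ℝ) : ℝ :=
  (∑ k, |f k| ^ p) ^ (1 / p)

section finLpNorm

variable {κ ι : Type*} [Fintype κ] {p : ℝ}

theorem finLpNorm_nonneg (f : κ → ℝ) : 0 ≤ finLpNorm p f := by
  unfold finLpNorm
  positivity

theorem finLpNorm_rpow (hp : 0 < p) (f : κ → ℝ) : finLpNorm p f ^ p = ∑ k, |f k| ^ p := by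
  rw [finLpNorm, ← Real.rpow_mul (by positivity), one_div_mul_cancel hp.ne', Real.rpow_one]

theorem finLpNorm_mono (hp : 0 < p) {f g : κ → ℝ} (h : ∀ k, |f k| ≤ |g k|) :
    finLpNorm p f ≤ finLpNorm p g := by
  unfold finLpNorm
  have := fun k => Real.rpow_le_rpow (abs_nonneg _) (h k) hp.le
  have := Finset.sum_le_sum fun k (_ : k ∈ Finset.univ) => this k
  gcongr

theorem finLpNorm_le_of_rpow_sum_le (hp : 0 < p) {κ' : Type*} [Fintype κ'] {f : κ → ℝ}
    {g : κ' → ℝ} (h : ∑ k, |f k| ^ p ≤ ∑ k, |g k| ^ p) : finLpNorm p f ≤ finLpNorm p g := by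
  unfold finLpNorm
  gcongr

theorem finLpNorm_abs (f : κ → ℝ) : finLpNorm p (fun k => |f k|) = finLpNorm p f := by
  simp [finLpNorm]

theorem finLpNorm_zero (hp : 0 < p) : finLpNorm p (fun _ : κ => 0) = 0 := by
  simp [finLpNorm, Real.zero_rpow hp.ne', Real.zero_rpow (inv_ne_zero hp.ne')]

theorem finLpNorm_smul (hp : 0 < p) (c : ℝ) (f : κ → ℝ) :
    finLpNorm p (fun k => c * f k) = |c| * finLpNorm p f := by
  simp only [finLpNorm, abs_mul]
  simp_rw [Real.mul_rpow (abs_nonneg _) (abs_nonneg _)]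
  rw [← Finset.mul_sum, Real.mul_rpow (by positivity) (by positivity),
    ← Real.rpow_mul (abs_nonneg c), mul_one_div_cancel hp.ne', Real.rpow_one]

theorem finLpNorm_add_le (hp : 1 ≤ p) (f g : κ → ℝ) :
    finLpNorm p (fun k => f k + g k) ≤ finLpNorm p f + finLpNorm p g :=
  Real.Lp_add_le _ f g hp

theorem finLpNorm_sum_le (hp : 1 ≤ p) (s : Finset ι) (f : ι → κ → ℝ) :
    finLpNorm p (fun k => ∑ i ∈ s, f i k) ≤ ∑ i ∈ s, finLpNorm p (f i) := by
  classical
  induction s using Finset.induction with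
  | empty => simp [finLpNorm_zero (by linarith : 0 < p)]
  | insert i s hi ih =>
    simp only [Finset.sum_insert hi]
    exact (finLpNorm_add_le hp _ _).trans (by gcongr)

theorem abs_le_finLpNorm (hp : 0 < p) (f : κ → ℝ) (k : κ) : |f k| ≤ finLpNorm p f := by
  have h := Finset.single_le_sum (f := fun k => |f k| ^ p) (fun _ _ => by positivity)
    (Finset.mem_univ k)
  rw [← finLpNorm_rpow hp] at h
  exact (Real.rpow_le_rpow_iff (abs_nonneg _) (finLpNorm_nonneg f) hp).1 h

/-- The `ℓ_p` norm is dominated by the `ℓ_2` norm when `2 ≤ p`. -/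
theorem finLpNorm_le_sqrt_sum_sq (hp : 2 ≤ p) (f : κ → ℝ) :
    finLpNorm p f ≤ √(∑ k, f k ^ 2) := by
  set σ := √(∑ k, f k ^ 2) with hσ
  have hσ0 : 0 ≤ σ := Real.sqrt_nonneg _
  have hσ2 : ∑ k, f k ^ 2 = σ ^ 2 := (Real.sq_sqrt (by positivity)).symm
  have hp0 : 0 < p := by linarith
  have split : ∀ t : ℝ, 0 ≤ t → t ^ p = t ^ 2 * t ^ (p - 2) := by
    intro t ht
    rw [← Real.rpow_natCast t 2, ← Real.rpow_add_of_nonneg ht (by norm_num) (by linarith)]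
    norm_num
  have hk : ∀ k, |f k| ≤ σ := fun k =>
    Real.abs_le_sqrt (Finset.single_le_sum (f := fun k => f k ^ 2)
      (fun _ _ => by positivity) (Finset.mem_univ k))
  rw [← Real.rpow_le_rpow_iff (finLpNorm_nonneg f) hσ0 hp0, finLpNorm_rpow hp0, split σ hσ0, ← hσ2,
    Finset.sum_mul]
  refine Finset.sum_le_sum fun k _ => ?_
  rw [split _ (abs_nonneg _), sq_abs]
  have : 0 ≤ p - 2 := by linarith
  gcongr
  exact hk k

end finLpNorm

/-! ### Discretization: norming finitely many vectors of `ℓ_p^ι` by a contraction into `ℓ_p^κ`,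
with `κ` depending only on the number of vectors -/

section blocks

variable {ι κ : Type*} [Fintype ι] [DecidableEq κ] {p : ℝ} (b : ι → κ) (g : ι → ℝ)

/-- The mass of the block `j` for the weight `g ^ p`. -/
noncomputable def blockMass (p : ℝ) (b : ι → κ) (g : ι → ℝ) (j : κ) : ℝ :=
  ∑ k with b k = j, g k ^ p

/-- The average of `f / g` over the block `j` for the weight `g ^ p`. -/
noncomputable def blockAverage (p : ℝ) (b : ι → κ) (g f : ι → ℝ) (j : κ) : ℝ :=
  (∑ k with b k = j, g k ^ (p - 1) * f k) / blockMass p b g j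

variable {b g}

theorem blockMass_nonneg (hg : ∀ k, 0 ≤ g k) (j : κ) : 0 ≤ blockMass p b g j :=
  Finset.sum_nonneg fun k _ => Real.rpow_nonneg (hg k) p

theorem blockMass_mul_blockAverage_rpow_le (hp : 1 < p) (hg : ∀ k, 0 ≤ g k) (f : ι → ℝ) (j : κ) :
    blockMass p b g j * |blockAverage p b g f j| ^ p ≤ ∑ k with b k = j, |f k| ^ p := by
  have hG := blockMass_nonneg (p := p) (b := b) hg j
  have hp0 : 0 < p := by linarith
  rcases hG.eq_or_lt with h0 | hpos
  · rw [← h0, zero_mul]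
    positivity
  set G := blockMass p b g j with hGdef
  have hpq := Real.HolderConjugate.conjExponent hp
  set q := p.conjExponent
  have hq : ∀ k, |g k ^ (p - 1)| ^ q = g k ^ p := by
    intro k
    rw [abs_of_nonneg (Real.rpow_nonneg (hg k) _), ← Real.rpow_mul (hg k), hpq.sub_one_mul_conj]
  have hH := Real.inner_le_Lp_mul_Lq (Finset.univ.filter fun k => b k = j)
    (fun k => |f k|) (fun k => g k ^ (p - 1)) hpq
  simp only [hq, abs_abs] at hH
  rw [← blockMass.eq_1 p b g, ← hGdef] at hH
  set S := ∑ k with b k = j, |f k| ^ p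
  have hS : 0 ≤ S := Finset.sum_nonneg fun k _ => by positivity
  have h1 : |∑ k with b k = j, g k ^ (p - 1) * f k| ≤ S ^ (1 / p) * G ^ (1 / q) := by
    refine (Finset.abs_sum_le_sum_abs _ _).trans (le_trans (le_of_eq ?_) hH)
    refine Finset.sum_congr rfl fun k _ => ?_
    rw [abs_mul, abs_of_nonneg (Real.rpow_nonneg (hg k) _), mul_comm]
  have h2 : |∑ k with b k = j, g k ^ (p - 1) * f k| ^ p ≤ S * G ^ (p - 1) := by
    refine (Real.rpow_le_rpow (abs_nonneg _) h1 hp0.le).trans (le_of_eq ?_)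
    rw [Real.mul_rpow (by positivity) (by positivity), ← Real.rpow_mul hS, ← Real.rpow_mul hG,
      one_div_mul_cancel hp0.ne', Real.rpow_one, ← hpq.div_conj_eq_sub_one]
    congr 2
    ring
  rw [blockAverage, abs_div, abs_of_pos hpos, Real.div_rpow (abs_nonneg _) hG, ← mul_div_assoc,
    div_le_iff₀ (by positivity)]
  calc G * |∑ k with b k = j, g k ^ (p - 1) * f k| ^ p ≤ G * (S * G ^ (p - 1)) := by gcongr
    _ = S * (G ^ (p - 1) * G) := by ring
    _ = S * G ^ p := by rw [Real.rpow_sub_one hpos.ne', div_mul_cancel₀ _ hpos.ne']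

theorem sum_blockAverage_rpow [Fintype κ] (hg : ∀ k, 0 ≤ g k) (f : ι → ℝ) :
    ∑ k, |g k * blockAverage p b g f (b k)| ^ p =
      ∑ j, blockMass p b g j * |blockAverage p b g f j| ^ p := by
  rw [← Finset.sum_fiberwise Finset.univ b]
  refine Finset.sum_congr rfl fun j _ => ?_
  rw [blockMass, Finset.sum_mul]
  refine Finset.sum_congr rfl fun k hk => ?_
  rw [(Finset.mem_filter.1 hk).2, abs_mul, abs_of_nonneg (hg k),
    Real.mul_rpow (hg k) (abs_nonneg _)]

theorem abs_sub_blockAverage_le (hp : 1 < p) (hg : ∀ k, 0 ≤ g k) {δ : ℝ} {f : ι → ℝ}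
    (hfg : ∀ k, g k = 0 → f k = 0)
    (hδ : ∀ k l, b l = b k → |f k * g l - g k * f l| ≤ δ * g k * g l) (k : ι) :
    |f k - g k * blockAverage p b g f (b k)| ≤ δ * g k := by
  rcases (hg k).eq_or_lt with h0 | hpos
  · simp [hfg k h0.symm, ← h0]
  have hG : 0 < blockMass p b g (b k) :=
    Finset.sum_pos' (fun l _ => Real.rpow_nonneg (hg l) p)
      ⟨k, by simp, Real.rpow_pos_of_pos hpos p⟩
  have hpow : ∀ l, g l ^ p = g l ^ (p - 1) * g l := by
    intro l
    conv_rhs => rw [← Real.rpow_one (g l), ← Real.rpow_mul (hg l), one_mul]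
    rw [← Real.rpow_add_of_nonneg (hg l) (by linarith) zero_le_one, sub_add_cancel]
  have hid : (f k - g k * blockAverage p b g f (b k)) * blockMass p b g (b k) =
      ∑ l with b l = b k, g l ^ (p - 1) * (f k * g l - g k * f l) := by
    rw [sub_mul, mul_assoc, blockAverage, div_mul_cancel₀ _ hG.ne', blockMass, Finset.mul_sum,
      Finset.mul_sum, ← Finset.sum_sub_distrib]
    refine Finset.sum_congr rfl fun l _ => ?_
    rw [hpow]
    ring
  refine le_of_mul_le_mul_right ?_ hG
  rw [← abs_of_pos hG, ← abs_mul, abs_of_pos hG, hid, blockMass, Finset.mul_sum]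
  refine (Finset.abs_sum_le_sum_abs _ _).trans (Finset.sum_le_sum fun l hl => ?_)
  have hl' := hδ k l (Finset.mem_filter.1 hl).2
  have hgl := Real.rpow_nonneg (hg l) (p - 1)
  rw [abs_mul, abs_of_nonneg hgl, hpow]
  calc g l ^ (p - 1) * |f k * g l - g k * f l| ≤ g l ^ (p - 1) * (δ * g k * g l) := by gcongr
    _ = δ * g k * (g l ^ (p - 1) * g l) := by ring

end blocks

/-- Buckets of ratios in `[-1, 1]` at scale `1 / (2n)`. -/
theorem exists_ratio_buckets {ι : Type*} (n : ℕ) (w : Fin n → ι → ℝ) (g : ι → ℝ)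
    (hg : ∀ k, 0 ≤ g k) (hw : ∀ i k, |w i k| ≤ g k) :
    ∃ b : ι → Fin n → Fin (4 * n + 1), ∀ i k l, b l = b k →
      |w i k * g l - g k * w i l| ≤ (1 / (2 * n : ℝ)) * g k * g l := by
  have hr : ∀ i k, |w i k / g k| ≤ 1 := fun i k => by
    rw [abs_div, abs_of_nonneg (hg k)]
    exact div_le_one_of_le₀ (hw i k) (hg k)
  have hlt : ∀ i k, ⌊(w i k / g k + 1) * (2 * n)⌋₊ < 4 * n + 1 := by
    intro i k
    have h := abs_le.1 (hr i k)
    refine Nat.lt_succ_of_le (Nat.floor_le_of_le ?_)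
    push_cast
    nlinarith [(Nat.cast_nonneg n : (0 : ℝ) ≤ n)]
  refine ⟨fun k i => ⟨_, hlt i k⟩, fun i k l h => ?_⟩
  have hfl : ⌊(w i l / g l + 1) * (2 * n)⌋₊ = ⌊(w i k / g k + 1) * (2 * n)⌋₊ := by
    simpa using congrFun h i
  have hn : (0 : ℝ) < n := by exact_mod_cast i.pos
  rcases (hg k).eq_or_lt with hk | hk
  · simp [← hk, abs_nonpos_iff.1 ((hw i k).trans hk.ge)]
  rcases (hg l).eq_or_lt with hl | hl
  · simp [← hl, abs_nonpos_iff.1 ((hw i l).trans hl.ge)]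
  have hk0 : 0 ≤ (w i k / g k + 1) * (2 * n) := by
    nlinarith [(abs_le.1 (hr i k)).1]
  have hl0 : 0 ≤ (w i l / g l + 1) * (2 * n) := by
    nlinarith [(abs_le.1 (hr i l)).1]
  have h1 := Nat.floor_le hk0
  have h2 := Nat.lt_floor_add_one ((w i k / g k + 1) * (2 * n))
  have h3 := Nat.floor_le hl0
  have h4 := Nat.lt_floor_add_one ((w i l / g l + 1) * (2 * n))
  rw [hfl] at h3 h4
  have hd : |w i k / g k - w i l / g l| ≤ 1 / (2 * n) := by
    have h2n : (0 : ℝ) < 2 * n := by positivity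
    rw [abs_le, ← neg_div, div_le_iff₀ h2n, le_div_iff₀ h2n]
    constructor <;> linarith
  have hid : w i k * g l - g k * w i l = (w i k / g k - w i l / g l) * (g k * g l) := by
    field_simp
  rw [hid, abs_mul, abs_of_pos (mul_pos hk hl), mul_assoc]
  gcongr

theorem exists_finLpNorm_contraction {ι : Type*} [Fintype ι] {p : ℝ} (hp : 1 < p) (n : ℕ)
    (w : Fin n → ι → ℝ) :
    ∃ c : (Fin n → Fin (4 * n + 1)) → ι → ℝ,
      (∀ f : ι → ℝ, finLpNorm p (fun j => ∑ k, c j k * f k) ≤ finLpNorm p f) ∧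
      ∑ i, finLpNorm p (w i) ≤ 2 * ∑ i, finLpNorm p (fun j => ∑ k, c j k * w i k) := by
  have hp0 : 0 < p := by linarith
  set g : ι → ℝ := fun k => ∑ i, |w i k|
  have hg : ∀ k, 0 ≤ g k := fun k => Finset.sum_nonneg fun i _ => abs_nonneg _
  have hw : ∀ i k, |w i k| ≤ g k := fun i k =>
    Finset.single_le_sum (f := fun i => |w i k|) (fun _ _ => abs_nonneg _) (Finset.mem_univ i)
  obtain ⟨b, hb⟩ := exists_ratio_buckets n w g hg hw
  have hc : ∀ (f : ι → ℝ) (j : Fin n → Fin (4 * n + 1)),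
      ∑ k, (if b k = j then blockMass p b g j ^ (1 / p) * g k ^ (p - 1) / blockMass p b g j
        else 0) * f k = blockMass p b g j ^ (1 / p) * blockAverage p b g f j := by
    intro f j
    simp only [ite_mul, zero_mul]
    rw [← Finset.sum_filter, blockAverage, ← mul_div_assoc, Finset.mul_sum, Finset.sum_div]
    exact Finset.sum_congr rfl fun k _ => by ring
  refine ⟨fun j k => if b k = j then blockMass p b g j ^ (1 / p) * g k ^ (p - 1) /
    blockMass p b g j else 0, ?_⟩
  simp only [hc]
  have hpow : ∀ (f : ι → ℝ) (j : Fin n → Fin (4 * n + 1)),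
      |blockMass p b g j ^ (1 / p) * blockAverage p b g f j| ^ p =
        blockMass p b g j * |blockAverage p b g f j| ^ p := by
    intro f j
    have hG := blockMass_nonneg (p := p) (b := b) hg j
    rw [abs_mul, abs_of_nonneg (by positivity), Real.mul_rpow (by positivity) (abs_nonneg _),
      ← Real.rpow_mul hG, one_div_mul_cancel hp0.ne', Real.rpow_one]
  constructor
  · intro f
    refine finLpNorm_le_of_rpow_sum_le hp0 ?_
    rw [← Finset.sum_fiberwise Finset.univ b]
    refine Finset.sum_le_sum fun j _ => ?_
    rw [hpow]
    exact blockMass_mul_blockAverage_rpow_le hp hg f j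
  · have hgn : finLpNorm p g ≤ ∑ i, finLpNorm p (w i) := by
      refine (finLpNorm_sum_le hp.le Finset.univ fun i k => |w i k|).trans (le_of_eq ?_)
      exact Finset.sum_congr rfl fun i _ => finLpNorm_abs _
    have hi : ∀ i, finLpNorm p (w i) ≤
        finLpNorm p (fun j => blockMass p b g j ^ (1 / p) * blockAverage p b g (w i) j) +
          1 / (2 * n) * finLpNorm p g := by
      intro i
      have hlift : finLpNorm p (fun k => g k * blockAverage p b g (w i) (b k)) ≤
          finLpNorm p (fun j => blockMass p b g j ^ (1 / p) * blockAverage p b g (w i) j) := by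
        refine finLpNorm_le_of_rpow_sum_le hp0 (le_of_eq ?_)
        simp only [hpow]
        exact sum_blockAverage_rpow hg (w i)
      have hrest : finLpNorm p (fun k => w i k - g k * blockAverage p b g (w i) (b k)) ≤
          1 / (2 * n) * finLpNorm p g := by
        have h0 : (0 : ℝ) ≤ 1 / (2 * n) := by positivity
        rw [← abs_of_nonneg h0, ← finLpNorm_smul hp0]
        refine finLpNorm_mono hp0 fun k => ?_
        rw [abs_of_nonneg (mul_nonneg h0 (hg k))]
        exact abs_sub_blockAverage_le hp hg
          (fun k hk => abs_nonpos_iff.1 ((hw i k).trans hk.le)) (hb i) k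
      have h := finLpNorm_add_le hp.le (fun k => g k * blockAverage p b g (w i) (b k))
        fun k => w i k - g k * blockAverage p b g (w i) (b k)
      simp only [add_sub_cancel] at h
      linarith
    have hsum := Finset.sum_le_sum fun i (_ : i ∈ Finset.univ) => hi i
    rw [Finset.sum_add_distrib, Finset.sum_const, Finset.card_univ, Fintype.card_fin,
      nsmul_eq_mul, ← mul_assoc] at hsum
    have hn : (n : ℝ) * (1 / (2 * n)) ≤ 1 / 2 := by
      rcases Nat.eq_zero_or_pos n with rfl | hn
      · norm_num
      · have : (0 : ℝ) < n := by exact_mod_cast hn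
        exact le_of_eq (by field_simp)
    have := mul_le_mul hn hgn (finLpNorm_nonneg g) (by norm_num)
    linarith

/-! ### Weakly `p`-summable families of functionals norming finitely many vectors of `Y` -/

section dual

variable {Y : Type*} [NormedAddCommGroup Y] [NormedSpace ℝ Y]

theorem IsLpSpaceWith.exists_linearMaps {p lam : ℝ} (hp : 1 < p) (hlam : 0 ≤ lam)
    (hY : IsLpSpaceWith p lam Y) {n : ℕ} (z : Fin n → Y) (s : Finset Y) :
    ∃ h : (Fin n → Fin (4 * n + 1)) → Y →ₗ[ℝ] ℝ,
      (∀ y ∈ s, finLpNorm p (fun j => h j y) ≤ ‖y‖) ∧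
      ∑ i, ‖z i‖ ≤ 2 * lam * ∑ i, finLpNorm p (fun j => h j (z i)) := by
  classical
  have hp0 : 0 < p := by linarith
  obtain ⟨Y₀, hE, -, v, a, b, ha, hb, hab⟩ := hY
    (Submodule.span ℝ (↑(s ∪ Finset.univ.image z) : Set Y)) inferInstance
  have hmem : ∀ y ∈ s ∪ Finset.univ.image z, y ∈ Y₀ := fun y hy => hE (Submodule.subset_span hy)
  have hs : ∀ y ∈ s, y ∈ Y₀ := fun y hy => hmem y (Finset.mem_union_left _ hy)
  have hz : ∀ i, z i ∈ Y₀ := fun i => hmem _ (Finset.mem_union_right _ (by simp))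
  replace ha : ∀ y : Y₀, finLpNorm p (v y) ≤ a * ‖y‖ := ha
  replace hb : ∀ y : Y₀, ‖y‖ ≤ b * finLpNorm p (v y) := fun y =>
    le_of_eq_of_le (by simp) (hb (v y))
  have hzero : (∀ i, z i = 0) ∨ 0 < a := by
    by_contra! hcon
    obtain ⟨⟨i, hi⟩, ha0⟩ := hcon
    have h1 := ha ⟨z i, hz i⟩
    have h2 := hb ⟨z i, hz i⟩
    have h3 : finLpNorm p (v ⟨z i, hz i⟩) = 0 := le_antisymm
      (h1.trans (mul_nonpos_of_nonpos_of_nonneg ha0 (norm_nonneg _))) (finLpNorm_nonneg _)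
    rw [h3, mul_zero] at h2
    exact hi (norm_le_zero_iff.1 h2)
  rcases hzero with hzero | ha0
  · refine ⟨0, fun y _ => ?_, ?_⟩
    · simp [finLpNorm_zero hp0]
    · simp [hzero, finLpNorm_zero hp0]
  obtain ⟨c, hc1, hc2⟩ := exists_finLpNorm_contraction hp n fun i => v ⟨z i, hz i⟩
  choose h hh using fun j => LinearMap.exists_extend
    ((a⁻¹ • ∑ k, c j k • LinearMap.proj k) ∘ₗ v.toLinearMap : Y₀ →ₗ[ℝ] ℝ)
  have hval : ∀ j (y : Y₀), h j y = a⁻¹ * ∑ k, c j k * v y k := fun j y => by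
    simpa using LinearMap.congr_fun (hh j) y
  have hnorm : ∀ y : Y₀, finLpNorm p (fun j => h j y) =
      a⁻¹ * finLpNorm p (fun j => ∑ k, c j k * v y k) := fun y => by
    simp only [hval]
    rw [finLpNorm_smul hp0, abs_of_pos (inv_pos.2 ha0)]
  refine ⟨h, fun y hy => ?_, ?_⟩
  · rw [hnorm ⟨y, hs y hy⟩, inv_mul_le_iff₀ ha0]
    exact (hc1 _).trans (ha ⟨y, hs y hy⟩)
  · have hS : (0 : ℝ) ≤ ∑ i, finLpNorm p (fun j => ∑ k, c j k * v ⟨z i, hz i⟩ k) :=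
      Finset.sum_nonneg fun i _ => finLpNorm_nonneg _
    have hS' : (0 : ℝ) ≤ ∑ i, finLpNorm p (v ⟨z i, hz i⟩) :=
      Finset.sum_nonneg fun i _ => finLpNorm_nonneg _
    simp only [fun i => hnorm ⟨z i, hz i⟩]
    rw [← Finset.mul_sum]
    have hba : b ≤ lam * a⁻¹ := by
      rw [le_mul_inv_iff₀ ha0]
      linarith
    calc ∑ i, ‖z i‖ ≤ ∑ i, b * finLpNorm p (v ⟨z i, hz i⟩) :=
          Finset.sum_le_sum fun i _ => hb ⟨z i, hz i⟩
      _ = b * ∑ i, finLpNorm p (v ⟨z i, hz i⟩) := by rw [Finset.mul_sum]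
      _ ≤ lam * a⁻¹ * ∑ i, finLpNorm p (v ⟨z i, hz i⟩) := by gcongr
      _ ≤ lam * a⁻¹ * (2 * ∑ i, finLpNorm p (fun j => ∑ k, c j k * v ⟨z i, hz i⟩ k)) := by
          gcongr
      _ = _ := by ring

theorem continuous_finLpNorm {p : ℝ} (hp : 0 < p) {κ : Type*} [Fintype κ] :
    Continuous fun f : κ → ℝ => finLpNorm p f := by
  have := hp.le
  unfold finLpNorm
  fun_prop (disch := positivity)

/-- Weak-star compactness: linear functionals bounded in `ℓ_p` on finite sets have a limit bounded
on the whole space. -/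
theorem exists_continuousLinearMaps_of_finset {p K : ℝ} (hp : 0 < p) {n : ℕ} {κ : Type*}
    [Fintype κ] (z : Fin n → Y)
    (H : ∀ s : Finset Y, ∃ h : κ → Y →ₗ[ℝ] ℝ,
      (∀ y ∈ s, finLpNorm p (fun j => h j y) ≤ ‖y‖) ∧
      ∑ i, ‖z i‖ ≤ K * ∑ i, finLpNorm p (fun j => h j (z i))) :
    ∃ h : κ → Y →L[ℝ] ℝ,
      (∀ y, finLpNorm p (fun j => h j y) ≤ ‖y‖) ∧
      ∑ i, ‖z i‖ ≤ K * ∑ i, finLpNorm p (fun j => h j (z i)) := by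
  classical
  choose h hbd hz using H
  let U : Ultrafilter (Finset Y) := Ultrafilter.of Filter.atTop
  have hU : ∀ y : Y, ∀ᶠ s in (U : Filter (Finset Y)), y ∈ s := fun y => by
    refine Ultrafilter.of_le Filter.atTop ?_
    filter_upwards [Filter.eventually_ge_atTop {y}] with s hs
    exact Finset.singleton_subset_iff.1 hs
  have hlim : ∀ j y, ∃ t : ℝ, Filter.Tendsto (fun s => h s j y) U (nhds t) := by
    intro j y
    have hc : IsCompact (Set.Icc (-‖y‖) ‖y‖) := isCompact_Icc
    obtain ⟨t, -, ht⟩ := hc.ultrafilter_le_nhds (U.map fun s => h s j y) (by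
      rw [Filter.le_principal_iff, Ultrafilter.mem_coe, Ultrafilter.mem_map]
      filter_upwards [hU y] with s hs
      exact abs_le.1 ((abs_le_finLpNorm hp (fun j => h s j y) j).trans (hbd s y hs)))
    exact ⟨t, ht⟩
  choose f hf using hlim
  have hfz : ∀ y, Filter.Tendsto (fun s => finLpNorm p fun j => h s j y) U
      (nhds (finLpNorm p fun j => f j y)) := fun y =>
    ((continuous_finLpNorm hp).tendsto _).comp (tendsto_pi_nhds.2 fun j => hf j y)
  have hfle : ∀ y, finLpNorm p (fun j => f j y) ≤ ‖y‖ := fun y =>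
    le_of_tendsto (hfz y) ((hU y).mono fun s hs => hbd s y hs)
  let F : κ → Y →ₗ[ℝ] ℝ := fun j =>
    { toFun := f j
      map_add' := fun x y => tendsto_nhds_unique (hf j (x + y)) (by
        simpa only [map_add] using (hf j x).add (hf j y))
      map_smul' := fun c y => tendsto_nhds_unique (hf j (c • y)) (by
        simpa only [map_smul, RingHom.id_apply] using (hf j y).const_smul c) }
  refine ⟨fun j => (F j).mkContinuous 1 fun y => ?_, hfle, ?_⟩
  · rw [one_mul]
    exact (abs_le_finLpNorm hp (fun j => f j y) j).trans (hfle y)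
  · exact ge_of_tendsto' ((tendsto_finsetSum Finset.univ fun i _ => hfz (z i)).const_mul K) hz

/-- A finite family of functionals that is contractive into `ℓ_p` has weak `ℓ_p` norm at most
`1`. -/
theorem weakNorm_le_one {p : ℝ} (hp : 1 < p) {n : ℕ} (h : Fin n → Y →L[ℝ] ℝ)
    (hh : ∀ y, finLpNorm p (fun j => h j y) ≤ ‖y‖) : weakNorm p h ≤ 1 := by
  have hp0 : 0 < p := by linarith
  have : Nonempty {φ : (Y →L[ℝ] ℝ) →L[ℝ] ℝ // ‖φ‖ ≤ 1} :=
    ⟨⟨0, ContinuousLinearMap.opNorm_le_bound _ zero_le_one fun _ => by simp⟩⟩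
  refine ciSup_le fun ⟨φ, hφ⟩ => ?_
  have hpq := Real.HolderConjugate.conjExponent hp
  set q := p.conjExponent
  set S := ∑ i, |φ (h i)| ^ p with hS
  have hS0 : 0 ≤ S := by positivity
  rcases hS0.eq_or_lt with h0 | hpos
  · rw [← h0, Real.zero_rpow (by positivity)]
    exact zero_le_one
  let a : Fin n → ℝ := fun i => SignType.sign (φ (h i)) * |φ (h i)| ^ (p - 1)
  have ha : ∀ i, a i * φ (h i) = |φ (h i)| ^ p := fun i => by
    rcases eq_or_ne (φ (h i)) 0 with hi | hi
    · simp [hi, Real.zero_rpow hp0.ne']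
    · have := abs_pos.2 hi
      simp only [a]
      rw [mul_right_comm, sign_mul_self, Real.rpow_sub_one this.ne', mul_div_cancel₀ _ this.ne']
  have haq : ∀ i, |a i| ^ q ≤ |φ (h i)| ^ p := fun i => by
    have h1 : |a i| ≤ |φ (h i)| ^ (p - 1) := by
      simp only [a]
      rw [abs_mul, abs_of_nonneg (Real.rpow_nonneg (abs_nonneg (φ (h i))) _)]
      refine mul_le_of_le_one_left (by positivity) ?_
      rcases lt_trichotomy (φ (h i)) 0 with hi | hi | hi <;> simp [hi]
    refine (Real.rpow_le_rpow (abs_nonneg _) h1 hpq.symm.nonneg).trans (le_of_eq ?_)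
    rw [← Real.rpow_mul (abs_nonneg _), hpq.sub_one_mul_conj]
  have hop : ‖∑ i, a i • h i‖ ≤ S ^ (1 / q) := by
    refine ContinuousLinearMap.opNorm_le_bound _ (by positivity) fun y => ?_
    have hsum : (∑ i, a i • h i) y = ∑ i, a i * h i y := by simp
    rw [hsum, Real.norm_eq_abs]
    have h1 := Real.inner_le_Lp_mul_Lq Finset.univ (fun i => |a i|) (fun i => |h i y|) hpq.symm
    simp only [abs_abs] at h1
    calc |∑ i, a i * h i y| ≤ ∑ i, |a i| * |h i y| := by
          simpa only [abs_mul] using Finset.abs_sum_le_sum_abs (fun i => a i * h i y) Finset.univ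
      _ ≤ _ := h1
      _ ≤ S ^ (1 / q) * ‖y‖ := by
          have := hpq.symm.nonneg
          refine mul_le_mul (Real.rpow_le_rpow (by positivity)
            (Finset.sum_le_sum fun i _ => haq i) (by positivity)) (hh y) (by positivity)
            (by positivity)
  have hSle : S ≤ S ^ (1 / q) :=
    calc S = φ (∑ i, a i • h i) := by simp [hS, ← ha]
      _ ≤ ‖φ‖ * ‖∑ i, a i • h i‖ := (le_abs_self _).trans (φ.le_opNorm _)
      _ ≤ 1 * S ^ (1 / q) := by gcongr
      _ = S ^ (1 / q) := one_mul _
  have hsplit : S ^ (1 / p) * S ^ (1 / q) = S := by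
    rw [← Real.rpow_add hpos, one_div, one_div, hpq.inv_add_inv_eq_one, Real.rpow_one]
  refine le_of_mul_le_mul_right ?_ (Real.rpow_pos_of_pos hpos (1 / q))
  rwa [hsplit, one_mul]

theorem IsLpSpaceWith.exists_weakNorm_le_one {p lam : ℝ} (hp : 1 < p) (hlam : 0 ≤ lam)
    (hY : IsLpSpaceWith p lam Y) {n : ℕ} (z : Fin n → Y) :
    ∃ (m : ℕ) (h : Fin m → Y →L[ℝ] ℝ), weakNorm p h ≤ 1 ∧
      ∑ i, ‖z i‖ ≤ 2 * lam * ∑ i, finLpNorm p (fun j => h j (z i)) := by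
  obtain ⟨h, h1, h2⟩ := exists_continuousLinearMaps_of_finset (by linarith : 0 < p) z
    (hY.exists_linearMaps hp hlam z)
  let e := (Fintype.equivFin (Fin n → Fin (4 * n + 1))).symm
  have he : ∀ y, finLpNorm p (fun j => h (e j) y) = finLpNorm p fun j => h j y := fun y =>
    congrArg (· ^ (1 / p)) (e.sum_comp fun j => |h j y| ^ p)
  refine ⟨_, fun j => h (e j), weakNorm_le_one hp _ fun y => (he y).trans_le (h1 y), ?_⟩
  simpa only [he] using h2

end dual

/-! ### The supremum over the unit ball of `X^#` -/

section lip

variable {X : Type*} [MetricSpace X]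

theorem lipNorm_nonneg (g : X → ℝ) : 0 ≤ lipNorm g :=
  Real.sInf_nonneg fun _ hK => hK.1

theorem abs_sub_le_lipNorm_mul_dist {g : X → ℝ} {K : ℝ≥0} (hg : LipschitzWith K g) (x y : X) :
    |g x - g y| ≤ lipNorm g * dist x y := by
  rcases (dist_nonneg (x := x) (y := y)).eq_or_lt with h0 | hpos
  · rw [dist_eq_zero.1 h0.symm]
    simp
  rw [← div_le_iff₀ hpos]
  refine le_csInf ⟨K, K.2, fun x y => ?_⟩ fun L hL => (div_le_iff₀ hpos).2 (hL.2 x y)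
  simpa [Real.dist_eq] using hg.dist_le_mul x y

theorem sum_abs_sub_le_lipNorm_mul_iSup {base : X} {g : X → ℝ} {K : ℝ≥0}
    (hg : LipschitzWith K g) (hbase : g base = 0) {n : ℕ} (x q : Fin n → X) :
    ∑ i, |g (x i) - g (q i)| ≤
      lipNorm g * ⨆ φ : {φ : X → ℝ // LipschitzWith 1 φ ∧ φ base = 0},
        ∑ i, |φ.1 (x i) - φ.1 (q i)| := by
  have hdist := abs_sub_le_lipNorm_mul_dist hg
  rcases (lipNorm_nonneg g).eq_or_lt with h0 | hpos
  · rw [← h0, zero_mul]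
    exact Finset.sum_nonpos fun i _ => by simpa [← h0] using hdist (x i) (q i)
  have hbdd : BddAbove (Set.range fun φ : {φ : X → ℝ // LipschitzWith 1 φ ∧ φ base = 0} =>
      ∑ i, |φ.1 (x i) - φ.1 (q i)|) := by
    refine ⟨∑ i, dist (x i) (q i), ?_⟩
    rintro _ ⟨φ, rfl⟩
    exact Finset.sum_le_sum fun i _ => by
      simpa [Real.dist_eq] using φ.2.1.dist_le_mul (x i) (q i)
  have hφ : LipschitzWith 1 fun y => (lipNorm g)⁻¹ * g y := by
    refine LipschitzWith.of_dist_le_mul fun y y' => ?_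
    rw [Real.dist_eq, ← mul_sub, abs_mul, abs_of_pos (inv_pos.2 hpos), NNReal.coe_one, one_mul,
      inv_mul_le_iff₀ hpos]
    exact hdist y y'
  have h := le_ciSup hbdd ⟨fun y => (lipNorm g)⁻¹ * g y, hφ, by simp [hbase]⟩
  simp only [← mul_sub, abs_mul, abs_of_pos (inv_pos.2 hpos)] at h
  rwa [← Finset.mul_sum, inv_mul_le_iff₀ hpos] at h

end lip

/-- An average over signs is at most the quadratic average. -/
theorem average_le_sqrt_average_sq {n : ℕ} (F : (Fin n → Bool) → ℝ) :
    (2 ^ n : ℝ)⁻¹ * ∑ ε, F ε ≤ √((2 ^ n : ℝ)⁻¹ * ∑ ε, F ε ^ 2) := by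
  refine Real.le_sqrt_of_sq_le ?_
  have h := sq_sum_le_card_mul_sum_sq (s := Finset.univ) (f := F)
  simp only [Finset.card_univ, Fintype.card_pi, Fintype.card_bool, Finset.prod_const,
    Fintype.card_fin, Nat.cast_pow, Nat.cast_ofNat] at h
  have hn : (0 : ℝ) < 2 ^ n := by positivity
  calc ((2 ^ n : ℝ)⁻¹ * ∑ ε, F ε) ^ 2 = ((2 ^ n : ℝ)⁻¹) ^ 2 * (∑ ε, F ε) ^ 2 := mul_pow _ _ _
    _ ≤ ((2 ^ n : ℝ)⁻¹) ^ 2 * (2 ^ n * ∑ ε, F ε ^ 2) := by gcongr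
    _ = (2 ^ n : ℝ)⁻¹ * ∑ ε, F ε ^ 2 := by field_simp

/-- **Extension of the Chen–Zheng theorem.** Let `X` be a pointed metric space, `2 ≤ p < ∞`,
and `Y` a real Banach `L_p`-space. If `T : X → Y` is Lipschitz with `T base = 0` and the
restriction of its Lipschitz adjoint to `Y*`, `ψ ↦ ψ ∘ T : Y* → X^#`, is almost `p`-summing,
then `T` is Lipschitz `1`-summing. -/
theorem chen_zheng_Lp {X Y : Type*} [MetricSpace X] (base : X)
    [NormedAddCommGroup Y] [NormedSpace ℝ Y] [CompleteSpace Y]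
    (p : ℝ) (hp : 2 ≤ p) (hY : ∃ lam : ℝ, 1 < lam ∧ IsLpSpaceWith p lam Y)
    (T : X → Y) (hT : ∃ L : ℝ≥0, LipschitzWith L T) (hT0 : T base = 0)
    (hadj : AlmostSummingIntoLip p (fun ψ : Y →L[ℝ] ℝ => fun x => ψ (T x))) :
    LipschitzOneSumming base T := by
  obtain ⟨lam, hlam, hY⟩ := hY
  obtain ⟨L, hT⟩ := hT
  obtain ⟨C, hC, hadj⟩ := hadj
  refine ⟨4 * lam * C, by positivity, fun n x q => ?_⟩
  obtain ⟨m, h, hw, hz⟩ :=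
    hY.exists_weakNorm_le_one (by linarith) (by linarith) fun i => T (x i) - T (q i)
  set S := ⨆ φ : {φ : X → ℝ // LipschitzWith 1 φ ∧ φ base = 0}, ∑ i, |φ.1 (x i) - φ.1 (q i)|
  have hS : 0 ≤ S := Real.iSup_nonneg fun φ => Finset.sum_nonneg fun i _ => abs_nonneg _
  let G : (Fin m → Bool) → X → ℝ := fun ε x => signSum (fun j => h j (T x)) ε
  have hG : ∀ ε, ∃ K : ℝ≥0, LipschitzWith K (G ε) := fun ε => by
    let Ψ : Y →L[ℝ] ℝ := ∑ j, (if ε j then (1 : ℝ) else -1) • h j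
    have heq : G ε = Ψ ∘ T := by
      ext x
      simp only [G, Ψ, signSum, Function.comp_apply, sum_apply, smul_apply, smul_eq_mul]
    exact ⟨_, heq ▸ Ψ.lipschitz.comp hT⟩
  have hGsub : ∀ ε y y', signSum (fun j => h j (T y - T y')) ε = G ε y - G ε y' := fun ε y y' => by
    simp only [G, signSum, map_sub, mul_sub, Finset.sum_sub_distrib]
  have hKhintchine : ∀ i, finLpNorm p (fun j => h j (T (x i) - T (q i))) ≤
      2 * ((2 ^ m : ℝ)⁻¹ * ∑ ε, |G ε (x i) - G ε (q i)|) := fun i => by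
    simp only [← hGsub]
    exact (finLpNorm_le_sqrt_sum_sq hp _).trans (sqrt_sum_sq_le_average_abs_signSum _)
  have hLip : ∀ ε, ∑ i, |G ε (x i) - G ε (q i)| ≤ lipNorm (G ε) * S := fun ε =>
    (hG ε).elim fun K hK => sum_abs_sub_le_lipNorm_mul_iSup hK (by simp [G, signSum, hT0]) x q
  have havg : (2 ^ m : ℝ)⁻¹ * ∑ ε, lipNorm (G ε) ≤ C :=
    calc _ ≤ √((2 ^ m : ℝ)⁻¹ * ∑ ε, lipNorm (G ε) ^ 2) := average_le_sqrt_average_sq _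
      _ ≤ C * weakNorm p h := hadj m h
      _ ≤ C * 1 := by gcongr
      _ = C := mul_one C
  calc ∑ i, ‖T (x i) - T (q i)‖
      ≤ 2 * lam * ∑ i, finLpNorm p (fun j => h j (T (x i) - T (q i))) := hz
    _ ≤ 2 * lam * ∑ i, 2 * ((2 ^ m : ℝ)⁻¹ * ∑ ε, |G ε (x i) - G ε (q i)|) := by
        gcongr with i
        exact hKhintchine i
    _ = 4 * lam * ((2 ^ m : ℝ)⁻¹ * ∑ ε, ∑ i, |G ε (x i) - G ε (q i)|) := by
        rw [← Finset.mul_sum, ← Finset.mul_sum, Finset.sum_comm]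
        ring
    _ ≤ 4 * lam * ((2 ^ m : ℝ)⁻¹ * ∑ ε, lipNorm (G ε) * S) := by
        gcongr with ε
        exact hLip ε
    _ = 4 * lam * ((2 ^ m : ℝ)⁻¹ * ∑ ε, lipNorm (G ε)) * S := by
        rw [← Finset.sum_mul]
        ring
    _ ≤ 4 * lam * C * S := by gcongr
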